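/- Let U be an open neighborhood of 0 in ℂ^n and φ : U → ℝ a C² function; let H be the complex Hessian of φ at 0. For each k ≥ 1 define the Bergman function at 0 by B_k(0) = sup{ |f(0)|² e^{-kφ(0)} : f holomorphic on U, ∫_U |f|² e^{-kφ} dλ ≤ 1 }. Then limsup_{k→∞} k^{-n} B_k(0) ≤ π^{-n} det H if H is positive definite, and limsup_{k→∞} k^{-n} B_k(0) = 0 (i.e. the limit is 0) if H is not positive definite. -/

import Mathlib

open MeasureTheory Filter ComplexOrder

/-- The complex Hessian `(∂²φ/∂z_i∂z̄_j(x))_{i,j}` of a real-valued `C²` function `φ` on an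
open subset of `ℂ^n`, expressed in terms of the real second derivative `D²φ(x)` of `φ`. -/
noncomputable def complexHessian (n : ℕ) (φ : (Fin n → ℂ) → ℝ) (x : Fin n → ℂ) :
    Matrix (Fin n) (Fin n) ℂ :=
  Matrix.of fun i j =>
    let D2 : (Fin n → ℂ) → (Fin n → ℂ) → ℝ := fun v w => fderiv ℝ (fderiv ℝ φ) x v w
    let e : Fin n → (Fin n → ℂ) := fun i => Pi.single i (1 : ℂ)
    ((1 : ℂ) / 4) * ((D2 (e i) (e j) + D2 (Complex.I • e i) (Complex.I • e j) : ℝ) : ℂ)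
      + (Complex.I / 4) * ((D2 (Complex.I • e i) (e j) - D2 (e i) (Complex.I • e j) : ℝ) : ℂ)

/-- The Bergman function at `0` of the space of holomorphic functions on `U` that are
square-integrable against the weight `e^{-kφ}`:
`B_k(0) = sup { |f(0)|² e^{-kφ(0)} : f holomorphic on U, ∫_U |f|² e^{-kφ} dλ ≤ 1 }`. -/
noncomputable def bergmanFnAtZero (n : ℕ) (U : Set (Fin n → ℂ)) (φ : (Fin n → ℂ) → ℝ)
    (k : ℕ) : ℝ :=
  sSup { r : ℝ | ∃ f : (Fin n → ℂ) → ℂ, DifferentiableOn ℂ f U ∧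
    (∫⁻ z in U, ENNReal.ofReal (‖f z‖ ^ 2 * Real.exp (-(k : ℝ) * φ z))) ≤ 1 ∧
    r = ‖f 0‖ ^ 2 * Real.exp (-(k : ℝ) * φ 0) }


/-- Tonelli for products of one-variable functions on `ℂ^n`. -/
theorem bm_lintegral_prod {n : ℕ} (f : Fin n → ℂ → ENNReal) (hf : ∀ i, Measurable (f i)) :
    ∫⁻ x : Fin n → ℂ, ∏ i, f i (x i) = ∏ i, ∫⁻ x, f i x := by
  induction n with
  | zero => simp [volume_pi]
  | succ n ih =>
    have h1 := (volume_preserving_piFinSuccAbove (fun _ : Fin (n+1) => ℂ) 0).symm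
    rw [← h1.lintegral_comp_emb (MeasurableEquiv.measurableEmbedding _)]
    rw [Fin.prod_univ_succ, ← ih (fun i => f i.succ) (fun i => hf _)]
    rw [← lintegral_prod_mul (hf 0).aemeasurable
      (Measurable.aemeasurable (Finset.measurable_prod _
        fun i _ => (hf i.succ).comp (measurable_pi_apply i)))]
    congr 1
    ext x
    simp [Fin.prod_univ_succ, MeasurableEquiv.piFinSuccAbove_symm_apply, Fin.insertNthEquiv]

theorem bm_gauss_pos {b : ℝ} (hb : 0 < b) :
    ∫⁻ w : ℂ, ENNReal.ofReal (Real.exp (-(b * ‖w‖ ^ 2))) = ENNReal.ofReal (Real.pi / b) := by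
  have h := GaussianFourier.integral_rexp_neg_mul_sq_norm (V := ℂ) hb
  simp only [Complex.finrank_real_complex] at h
  norm_num at h
  rw [← h, ofReal_integral_eq_lintegral_ofReal]
  · by_contra hc
    rw [integral_undef hc] at h
    have : 0 < Real.pi / b := by positivity
    linarith
  · exact Eventually.of_forall fun x => (Real.exp_pos _).le

theorem bm_gauss_nonpos {b : ℝ} (hb : b ≤ 0) :
    ∫⁻ w : ℂ, ENNReal.ofReal (Real.exp (-(b * ‖w‖ ^ 2))) = ⊤ := by
  rw [eq_top_iff]
  calc (⊤ : ENNReal) = ∫⁻ w : ℂ, 1 := by simp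
    _ ≤ _ := by
      apply lintegral_mono
      intro w
      simp only [ENNReal.one_le_ofReal, Real.one_le_exp_iff]
      nlinarith [sq_nonneg ‖w‖]

theorem bm_unitary_mp {n : ℕ} (V : Matrix (Fin n) (Fin n) ℂ) (hV : V ∈ Matrix.unitaryGroup (Fin n) ℂ) :
    MeasurePreserving (fun z : Fin n → ℂ => V.mulVec z) := by
  have hdet : Complex.normSq V.det = 1 := by
    have h := (Matrix.det_of_mem_unitary hV)
    have h2 := CStarRing.norm_of_mem_unitary h
    rw [Complex.normSq_eq_norm_sq, h2]; norm_num
  let f : (Fin n → ℂ) →ₗ[ℝ] (Fin n → ℂ) := (Matrix.toLin' V).restrictScalars ℝ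
  have hf : LinearMap.det f = 1 := by
    simp only [f, LinearMap.det_restrictScalars, LinearMap.det_toLin', Algebra.norm_complex_apply, hdet]
  refine ⟨by fun_prop, ?_⟩
  have := Measure.map_linearMap_addHaar_eq_smul_addHaar (volume : Measure (Fin n → ℂ)) (f := f) (by rw [hf]; simp)
  rw [hf] at this
  simp only [inv_one, abs_one, ENNReal.ofReal_one, one_smul] at this
  exact this

theorem bm_diag {n : ℕ} {A : Matrix (Fin n) (Fin n) ℂ} (hA : A.IsHermitian) (w : Fin n → ℂ) :
    (star ((hA.eigenvectorUnitary : Matrix (Fin n) (Fin n) ℂ).mulVec w) ⬝ᵥ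
      A.mulVec ((hA.eigenvectorUnitary : Matrix (Fin n) (Fin n) ℂ).mulVec w)).re
      = ∑ i, hA.eigenvalues i * ‖w i‖ ^ 2 := by
  have h := hA.conjStarAlgAut_star_eigenvectorUnitary
  rw [Unitary.conjStarAlgAut_apply] at h
  set V := (hA.eigenvectorUnitary : Matrix (Fin n) (Fin n) ℂ) with hV
  have h' : star V * A * V = Matrix.diagonal (RCLike.ofReal ∘ hA.eigenvalues) := by
    simpa using h
  rw [Matrix.star_mulVec, Matrix.dotProduct_mulVec, Matrix.vecMul_vecMul, Matrix.dotProduct_mulVec,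
    Matrix.vecMul_vecMul, ← Matrix.star_eq_conjTranspose, h', ← Matrix.dotProduct_mulVec]
  simp only [Matrix.mulVec_diagonal, dotProduct, Complex.re_sum]
  congr 1; ext i
  simp [Complex.sq_norm, Complex.normSq_apply]
  ring

/-- The full Gaussian integral of a Hermitian form. -/
theorem bm_gauss {n : ℕ} {A : Matrix (Fin n) (Fin n) ℂ} (hA : A.IsHermitian) :
    ∫⁻ z : Fin n → ℂ, ENNReal.ofReal (Real.exp (-(star z ⬝ᵥ A.mulVec z).re))
      = ∏ i, ∫⁻ w : ℂ, ENNReal.ofReal (Real.exp (-(hA.eigenvalues i * ‖w‖ ^ 2))) := by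
  rw [← bm_lintegral_prod _ (fun i => by fun_prop)]
  rw [← (bm_unitary_mp _ hA.eigenvectorUnitary.2).lintegral_comp (by
    simp only [dotProduct, Matrix.mulVec]; fun_prop)]
  congr 1; ext w
  rw [bm_diag, ← ENNReal.ofReal_prod_of_nonneg (fun i _ => (Real.exp_pos _).le), ← Real.exp_sum]
  simp

theorem bm_gauss_posDef {n : ℕ} {A : Matrix (Fin n) (Fin n) ℂ} (hA : A.PosDef) :
    ∫⁻ z : Fin n → ℂ, ENNReal.ofReal (Real.exp (-(star z ⬝ᵥ A.mulVec z).re))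
      = ENNReal.ofReal (Real.pi ^ n / A.det.re) := by
  have hp := hA.isHermitian.posDef_iff_eigenvalues_pos.1 hA
  rw [bm_gauss hA.isHermitian, Finset.prod_congr rfl (fun i _ => bm_gauss_pos (hp i)),
    ← ENNReal.ofReal_prod_of_nonneg (fun i _ => (div_pos Real.pi_pos (hp i)).le),
    hA.isHermitian.det_eq_prod_eigenvalues, Finset.prod_div_distrib]
  congr 2
  · simp
  · norm_cast

theorem bm_gauss_not_posDef {n : ℕ} {A : Matrix (Fin n) (Fin n) ℂ} (hA : A.IsHermitian)
    (hn : ¬ A.PosDef) :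
    ∫⁻ z : Fin n → ℂ, ENNReal.ofReal (Real.exp (-(star z ⬝ᵥ A.mulVec z).re)) = ⊤ := by
  rw [hA.posDef_iff_eigenvalues_pos] at hn
  push Not at hn
  obtain ⟨i, hi⟩ := hn
  rw [bm_gauss hA, ← Finset.mul_prod_erase _ _ (Finset.mem_univ i), bm_gauss_nonpos hi]
  apply ENNReal.top_mul
  rw [Finset.prod_ne_zero_iff]
  intro j _
  by_cases hj : 0 < hA.eigenvalues j
  · rw [bm_gauss_pos hj]
    have : 0 < Real.pi / hA.eigenvalues j := by positivity
    simpa using this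
  · rw [bm_gauss_nonpos (not_lt.1 hj)]; simp

/-- Sub-mean value property of `|F|²` on a ball with a circle-invariant weight. -/
theorem bm_mean {n : ℕ} {r : ℝ} (F : (Fin n → ℂ) → ℂ) (hF : ContinuousOn F (Metric.ball 0 r))
    (hd : ∀ z ∈ Metric.ball (0 : Fin n → ℂ) r,
      DifferentiableOn ℂ (fun t : ℂ => F (t • z)) (Metric.closedBall 0 1))
    (Λ : (Fin n → ℂ) → ℝ) (hΛ : Continuous Λ) (hrot : ∀ (t : ℂ) z, ‖t‖ = 1 → Λ (t • z) = Λ z) :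
    ENNReal.ofReal (‖F 0‖ ^ 2) * ∫⁻ z in Metric.ball 0 r, ENNReal.ofReal (Real.exp (-Λ z))
      ≤ ∫⁻ z in Metric.ball 0 r, ENNReal.ofReal (‖F z‖ ^ 2 * Real.exp (-Λ z)) := by
  set B : Set (Fin n → ℂ) := Metric.ball 0 r with hB
  have hBm : MeasurableSet B := Metric.isOpen_ball.measurableSet
  have hBrot : ∀ (t : ℂ) z, ‖t‖ = 1 → (t • z ∈ B ↔ z ∈ B) := by
    intro t z ht; simp [hB, norm_smul, ht]
  set G : (Fin n → ℂ) → ENNReal :=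
    B.indicator (fun z => ENNReal.ofReal (‖F z‖ ^ 2 * Real.exp (-Λ z))) with hG
  have hGm : Measurable G := by
    classical
    rw [hG, ← Set.piecewise_eq_indicator]
    refine ContinuousOn.measurable_piecewise ?_ continuousOn_const hBm
    exact ENNReal.continuous_ofReal.comp_continuousOn (by fun_prop)
  set I : Set ℝ := Set.Ioc 0 (2 * Real.pi) with hI
  let e : ℝ → ℂ := fun θ => circleMap 0 1 θ
  have he : Continuous e := continuous_circleMap 0 1
  have hen : ∀ θ, ‖e θ‖ = 1 := by intro θ; simp [e]
  have key : ∀ z ∈ B, ENNReal.ofReal (2 * Real.pi) * ENNReal.ofReal (‖F 0‖ ^ 2)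
      ≤ ∫⁻ θ in I, ENNReal.ofReal (‖F (e θ • z)‖ ^ 2) := by
    intro z hz
    have hsub : ContinuousOn (fun θ => F (e θ • z)) Set.univ := by
      refine hF.comp (by fun_prop) ?_
      intro θ _
      exact (hBrot _ _ (hen θ)).2 hz
    have hc : Continuous (fun θ => F (e θ • z)) := by
      rwa [continuousOn_univ] at hsub
    have hdiff : DifferentiableOn ℂ (fun t : ℂ => F (t • z) ^ 2) (Metric.closedBall 0 1) :=
      (hd z hz).pow 2
    have hav := DiffContOnCl.circleAverage (c := 0) (R := 1) (f := fun t : ℂ => F (t • z) ^ 2)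
      (by
        apply DifferentiableOn.diffContOnCl
        rw [abs_one, closure_ball _ one_ne_zero]; exact hdiff)
    rw [Real.circleAverage_def] at hav
    have h2 : (2 * Real.pi) * ‖F 0‖ ^ 2 ≤ ∫ θ in (0:ℝ)..2 * Real.pi, ‖F (e θ • z)‖ ^ 2 := by
      have h3 : ∫ θ in (0:ℝ)..2 * Real.pi, F (e θ • z) ^ 2 = (2 * Real.pi : ℝ) • F 0 ^ 2 := by
        simp only [zero_smul] at hav
        rw [← hav, smul_smul, mul_inv_cancel₀ (by positivity), one_smul]
      have h4 := intervalIntegral.norm_integral_le_integral_norm (μ := volume)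
        (f := fun θ => F (e θ • z) ^ 2)
        (show (0:ℝ) ≤ 2 * Real.pi by positivity)
      rw [h3, norm_smul, norm_pow, Real.norm_of_nonneg (by positivity)] at h4
      simpa using h4
    rw [← ENNReal.ofReal_mul (by positivity)]
    refine (ENNReal.ofReal_le_ofReal h2).trans ?_
    rw [intervalIntegral.integral_of_le (by positivity), ofReal_integral_eq_lintegral_ofReal]
    · have : Continuous (fun θ => ‖F (e θ • z)‖ ^ 2) := hc.norm.pow 2
      exact (this.integrableOn_Icc).mono_set Set.Ioc_subset_Icc_self
    · exact Eventually.of_forall fun x => by positivity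
  have key2 : ∀ z, B.indicator (fun z => ENNReal.ofReal (2 * Real.pi) *
      (ENNReal.ofReal (‖F 0‖ ^ 2) * ENNReal.ofReal (Real.exp (-Λ z)))) z ≤ ∫⁻ θ in I, G (e θ • z) := by
    intro z
    by_cases hz : z ∈ B
    · have h5 : ∀ θ, G (e θ • z) = ENNReal.ofReal (‖F (e θ • z)‖ ^ 2) * ENNReal.ofReal (Real.exp (-Λ z)) := by
        intro θ
        rw [hG, Set.indicator_of_mem ((hBrot _ _ (hen θ)).2 hz), hrot _ _ (hen θ),
          ENNReal.ofReal_mul (by positivity)]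
      simp only [h5, Set.indicator_of_mem hz]
      rw [lintegral_mul_const' _ _ ENNReal.ofReal_ne_top, ← mul_assoc]
      gcongr
      exact key z hz
    · simp [hz]
  have hmp : ∀ θ, ∫⁻ z, G (e θ • z) = ∫⁻ z, G z := by
    intro θ
    have h6 : MeasurePreserving (fun z : Fin n → ℂ => (e θ) • z) := by
      have h7 : MeasurePreserving (fun w : ℂ => e θ * w) := by
        have := (rotation ⟨e θ, by simp [Submonoid.unitSphere, hen]⟩).measurePreserving
        exact this
      exact volume_preserving_pi (fun _ => h7)
    exact h6.lintegral_comp hGm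
  have htot : ∫⁻ z, B.indicator (fun z => ENNReal.ofReal (2 * Real.pi) *
      (ENNReal.ofReal (‖F 0‖ ^ 2) * ENNReal.ofReal (Real.exp (-Λ z)))) z
      ≤ ENNReal.ofReal (2 * Real.pi) * ∫⁻ z, G z := by
    refine (lintegral_mono key2).trans ?_
    rw [lintegral_lintegral_swap]
    · simp only [hmp]
      simp [hI, mul_comm]
    · apply Measurable.aemeasurable
      apply hGm.comp
      fun_prop
  rw [lintegral_indicator hBm, lintegral_const_mul' _ _ ENNReal.ofReal_ne_top,
    lintegral_const_mul' _ _ ENNReal.ofReal_ne_top,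
    hG, lintegral_indicator hBm] at htot
  rwa [ENNReal.mul_le_mul_iff_right (by simp [Real.pi_pos]) ENNReal.ofReal_ne_top] at htot

theorem bm_scale {n : ℕ} {k R : ℝ} (hk : 0 < k) (Λ : (Fin n → ℂ) → ℝ)
    (hΛ2 : ∀ (t : ℝ) z, Λ (t • z) = t ^ 2 * Λ z) :
    ∫⁻ z in Metric.ball (0 : Fin n → ℂ) (R / √k), ENNReal.ofReal (Real.exp (-(k * Λ z)))
      = ENNReal.ofReal ((k ^ n)⁻¹) *
        ∫⁻ z in Metric.ball (0 : Fin n → ℂ) R, ENNReal.ofReal (Real.exp (-Λ z)) := by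
  have hs : 0 < √k := Real.sqrt_pos.2 hk
  have hmap := Measure.map_addHaar_smul (volume : Measure (Fin n → ℂ)) hs.ne'
  have hfr : Module.finrank ℝ (Fin n → ℂ) = n * 2 := by
    rw [Module.finrank_pi_fintype]; simp
  have hpow : |(√k ^ Module.finrank ℝ (Fin n → ℂ))⁻¹| = (k ^ n)⁻¹ := by
    rw [hfr, mul_comm, pow_mul, Real.sq_sqrt hk.le, abs_of_pos (by positivity)]
  rw [hpow] at hmap
  rw [← smul_eq_mul, ← lintegral_smul_measure, ← Measure.restrict_smul, ← hmap]
  have hemb : MeasurableEmbedding (fun z : Fin n → ℂ => √k • z) :=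
    (Homeomorph.smulOfNeZero (√k) hs.ne').measurableEmbedding
  rw [hemb.restrict_map, hemb.lintegral_map]
  have hpre : (fun z : Fin n → ℂ => √k • z) ⁻¹' Metric.ball 0 R = Metric.ball 0 (R / √k) := by
    ext z
    simp [norm_smul, abs_of_pos hs, lt_div_iff₀ hs, mul_comm]
  rw [hpre]
  simp only [hΛ2, Real.sq_sqrt hk.le]

theorem bm_taylor {E : Type*} [NormedAddCommGroup E] [NormedSpace ℝ E] {φ : E → ℝ}
    (hφ : ContDiffAt ℝ 2 φ 0) {ε : ℝ} (hε : 0 < ε) :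
    ∃ δ > 0, ∀ z ∈ Metric.ball (0 : E) δ,
      |φ z - φ 0 - fderiv ℝ φ 0 z - (1 / 2) * fderiv ℝ (fderiv ℝ φ) 0 z z| ≤ ε * ‖z‖ ^ 2 := by
  have hsymm : IsSymmSndFDerivAt ℝ φ 0 := hφ.isSymmSndFDerivAt (by simp)
  have hd1 : ∀ᶠ z in nhds (0 : E), DifferentiableAt ℝ φ z := by
    have := hφ.eventually (by simp)
    filter_upwards [this] with z hz using hz.differentiableAt (by simp)
  have hd2 : DifferentiableAt ℝ (fderiv ℝ φ) 0 :=
    (hφ.fderiv_right (m := 1) (by norm_num)).differentiableAt (by simp)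
  set D := fderiv ℝ (fderiv ℝ φ) 0 with hD
  have hlo := (hasFDerivAt_iff_isLittleO_nhds_zero.1 hd2.hasFDerivAt).def hε
  simp only [zero_add] at hlo
  obtain ⟨δ, hδ, hball⟩ := Metric.eventually_nhds_iff_ball.1 (hd1.and hlo)
  refine ⟨δ, hδ, fun z hz => ?_⟩
  let h : E → ℝ := fun z => φ z - φ 0 - fderiv ℝ φ 0 z - (1 / 2) * D z z
  let h' : E → (E →L[ℝ] ℝ) := fun w => fderiv ℝ φ w - fderiv ℝ φ 0 - D w
  have hder : ∀ w ∈ Metric.ball (0:E) δ, HasFDerivAt h (h' w) w := by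
    intro w hw
    have h1 := (hball w hw).1.hasFDerivAt
    have h2 : HasFDerivAt (fun z => D z z) (D w + D.flip w) w := by
      have := (D.hasFDerivAt (x := w)).clm_apply (hasFDerivAt_id (𝕜 := ℝ) w)
      refine this.congr_fderiv ?_
      ext v; simp
    have h3 := ((h1.sub_const (φ 0)).sub (fderiv ℝ φ 0).hasFDerivAt).sub (h2.const_mul (1/2))
    refine h3.congr_fderiv ?_
    ext v
    have := hsymm v w
    simp only [h', sub_apply, smul_apply, add_apply,
      ContinuousLinearMap.flip_apply, smul_eq_mul]
    rw [← hD] at this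
    rw [this]; ring
  have hzball : Metric.closedBall (0:E) ‖z‖ ⊆ Metric.ball 0 δ := by
    apply Metric.closedBall_subset_ball; simpa using hz
  have hmv := (convex_closedBall (0:E) ‖z‖).norm_image_sub_le_of_norm_hasFDerivWithin_le
    (f := h) (f' := h') (C := ε * ‖z‖) (x := 0) (y := z)
    (fun w hw => (hder w (hzball hw)).hasFDerivWithinAt)
    (fun w hw => by
      refine ((hball w (hzball hw)).2).trans ?_
      have : ‖w‖ ≤ ‖z‖ := by simpa using hw
      gcongr) (by simp) (by simp)
  have h0 : h 0 = 0 := by simp [h]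
  rw [h0, sub_zero, sub_zero, Real.norm_eq_abs] at hmv
  calc _ = |h z| := rfl
    _ ≤ _ := hmv
    _ = _ := by ring

/-- The Levi form attached to a real bilinear form. -/
noncomputable def bmLevi {n : ℕ} (B : (Fin n → ℂ) →L[ℝ] (Fin n → ℂ) →L[ℝ] ℝ) (z : Fin n → ℂ) : ℝ :=
  (1 / 4) * (B z z + B (Complex.I • z) (Complex.I • z))

/-- The complex linear part of the pluriharmonic polynomial. -/
noncomputable def bmLin {n : ℕ} (L : (Fin n → ℂ) →L[ℝ] ℝ) (z : Fin n → ℂ) : ℂ :=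
  (L z : ℂ) - Complex.I * (L (Complex.I • z) : ℂ)

/-- The complex quadratic part of the pluriharmonic polynomial. -/
noncomputable def bmQuad {n : ℕ} (B : (Fin n → ℂ) →L[ℝ] (Fin n → ℂ) →L[ℝ] ℝ) (z : Fin n → ℂ) : ℂ :=
  (1 / 4) * (((B z z - B (Complex.I • z) (Complex.I • z) : ℝ) : ℂ)
    - Complex.I * ((B z (Complex.I • z) + B (Complex.I • z) z : ℝ) : ℂ))

theorem bm_smul_eq {n : ℕ} (t : ℂ) (z : Fin n → ℂ) :
    t • z = t.re • z + t.im • (Complex.I • z) := by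
  ext i
  simp only [Pi.smul_apply, Pi.add_apply, smul_eq_mul, Complex.real_smul]
  conv_lhs => rw [← Complex.re_add_im t]
  ring

theorem bm_I_smul_eq {n : ℕ} (t : ℂ) (z : Fin n → ℂ) :
    Complex.I • t • z = t.re • (Complex.I • z) + (-t.im) • z := by
  ext i
  simp only [Pi.smul_apply, Pi.add_apply, smul_eq_mul, Complex.real_smul]
  conv_lhs => rw [← Complex.re_add_im t]
  push_cast
  linear_combination (t.im * z i : ℂ) * Complex.I_mul_I

theorem bmLin_smul {n : ℕ} (L : (Fin n → ℂ) →L[ℝ] ℝ) (t : ℂ) (z : Fin n → ℂ) :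
    bmLin L (t • z) = t * bmLin L z := by
  rw [bmLin, bm_I_smul_eq, bm_smul_eq]
  simp only [map_add, map_smul, smul_eq_mul, bmLin]
  apply Complex.ext <;> simp <;> ring

theorem bmQuad_smul {n : ℕ} (B : (Fin n → ℂ) →L[ℝ] (Fin n → ℂ) →L[ℝ] ℝ) (t : ℂ) (z : Fin n → ℂ) :
    bmQuad B (t • z) = t ^ 2 * bmQuad B z := by
  rw [bmQuad, bm_I_smul_eq, bm_smul_eq]
  simp only [map_add, map_smul, smul_eq_mul, bmQuad, add_apply, smul_apply]
  apply Complex.ext <;> simp [pow_two] <;> ring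

theorem bmLevi_smul {n : ℕ} (B : (Fin n → ℂ) →L[ℝ] (Fin n → ℂ) →L[ℝ] ℝ) (t : ℂ) (z : Fin n → ℂ) :
    bmLevi B (t • z) = ‖t‖ ^ 2 * bmLevi B z := by
  rw [bmLevi, bm_I_smul_eq, bm_smul_eq]
  simp only [map_add, map_smul, smul_eq_mul, bmLevi, add_apply, smul_apply,
    Complex.sq_norm, Complex.normSq_apply]
  ring

theorem bm_re {n : ℕ} (L : (Fin n → ℂ) →L[ℝ] ℝ) (B : (Fin n → ℂ) →L[ℝ] (Fin n → ℂ) →L[ℝ] ℝ)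
    (z : Fin n → ℂ) :
    (bmLin L z + bmQuad B z).re + bmLevi B z = L z + (1 / 2) * B z z := by
  simp [bmLin, bmQuad, bmLevi]
  ring

theorem bmLevi_cont {n : ℕ} (B : (Fin n → ℂ) →L[ℝ] (Fin n → ℂ) →L[ℝ] ℝ) : Continuous (bmLevi B) := by
  unfold bmLevi; fun_prop

/-- The sesquilinear form attached to a real bilinear form. -/
noncomputable def bmSesq {n : ℕ} (B : (Fin n → ℂ) →L[ℝ] (Fin n → ℂ) →L[ℝ] ℝ) :
    (Fin n → ℂ) →ₗ⋆[ℂ] (Fin n → ℂ) →ₗ[ℂ] ℂ :=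
  LinearMap.mk₂'ₛₗ (starRingEnd ℂ) (RingHom.id ℂ)
    (fun v w => ((1 : ℂ) / 4) * ((B v w + B (Complex.I • v) (Complex.I • w) : ℝ) : ℂ)
      + (Complex.I / 4) * ((B (Complex.I • v) w - B v (Complex.I • w) : ℝ) : ℂ))
    (by intro a b c; simp only [smul_add, map_add, add_apply]; push_cast; ring)
    (by
      intro t v w
      rw [bm_I_smul_eq, bm_smul_eq]
      simp only [map_add, map_smul, smul_eq_mul, add_apply, smul_apply]
      apply Complex.ext <;> simp <;> ring)
    (by intro a b c; simp only [smul_add, map_add]; push_cast; ring)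
    (by
      intro t v w
      rw [bm_I_smul_eq, bm_smul_eq]
      simp only [map_add, map_smul, smul_eq_mul]
      apply Complex.ext <;> simp <;> ring)

theorem bm_hess_apply {n : ℕ} (φ : (Fin n → ℂ) → ℝ) (i j : Fin n) :
    complexHessian n φ 0 i j = bmSesq (fderiv ℝ (fderiv ℝ φ) 0) (Pi.single i 1) (Pi.single j 1) := by
  simp only [complexHessian, Matrix.of_apply, bmSesq, LinearMap.mk₂'ₛₗ_apply]

theorem bm_form {n : ℕ} (φ : (Fin n → ℂ) → ℝ) (z : Fin n → ℂ) :
    (star z ⬝ᵥ (complexHessian n φ 0).mulVec z).re = bmLevi (fderiv ℝ (fderiv ℝ φ) 0) z := by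
  set S := bmSesq (fderiv ℝ (fderiv ℝ φ) 0) with hS
  have hz : z = ∑ i, z i • (Pi.single i (1 : ℂ) : Fin n → ℂ) := by
    ext j; simp [Finset.sum_apply, Pi.single_apply]
  have h1 : S z z = star z ⬝ᵥ (complexHessian n φ 0).mulVec z := by
    conv_lhs => rw [hz]
    simp only [map_sum, LinearMap.sum_apply, map_smulₛₗ, LinearMap.smul_apply, dotProduct, Matrix.mulVec,
      bm_hess_apply, ← hS, smul_eq_mul, Finset.mul_sum, RingHom.id_apply, Pi.star_apply]
    rw [Finset.sum_comm]
    refine Finset.sum_congr rfl fun i _ => Finset.sum_congr rfl fun j _ => ?_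
    simp only [starRingEnd_apply]
    ring
  rw [← h1, hS]
  simp [bmSesq, LinearMap.mk₂'ₛₗ_apply, bmLevi]

theorem bm_herm {n : ℕ} {φ : (Fin n → ℂ) → ℝ} (hφ : ContDiffAt ℝ 2 φ 0) :
    (complexHessian n φ 0).IsHermitian := by
  have hsymm : IsSymmSndFDerivAt ℝ φ 0 := hφ.isSymmSndFDerivAt (by simp)
  ext i j
  rw [Matrix.conjTranspose_apply]
  simp only [complexHessian, Matrix.of_apply]
  rw [hsymm (Pi.single j 1) (Pi.single i 1), hsymm (Complex.I • Pi.single j 1) (Pi.single i 1),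
    hsymm (Pi.single j 1) (Complex.I • Pi.single i 1),
    hsymm (Complex.I • Pi.single j 1) (Complex.I • Pi.single i 1)]
  apply Complex.ext <;> simp <;> ring

theorem bm_core {n : ℕ} {U : Set (Fin n → ℂ)} (hU : IsOpen U) (h0U : (0 : Fin n → ℂ) ∈ U)
    {φ : (Fin n → ℂ) → ℝ} (hφ : ContDiffAt ℝ 2 φ 0) {R ε : ℝ} (hR : 0 < R) (hε : 0 < ε) :
    ∀ᶠ k : ℕ in atTop, ∀ f : (Fin n → ℂ) → ℂ, DifferentiableOn ℂ f U →
      (∫⁻ z in U, ENNReal.ofReal (‖f z‖ ^ 2 * Real.exp (-(k : ℝ) * φ z))) ≤ 1 →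
      ENNReal.ofReal (((k : ℝ) ^ n)⁻¹ * (‖f 0‖ ^ 2 * Real.exp (-(k : ℝ) * φ 0))) *
        (∫⁻ z in Metric.ball (0 : Fin n → ℂ) R,
          ENNReal.ofReal (Real.exp (-bmLevi (fderiv ℝ (fderiv ℝ φ) 0) z)))
      ≤ ENNReal.ofReal (Real.exp ε) := by
  obtain ⟨δ, hδ, hT⟩ := bm_taylor hφ (show 0 < ε / R ^ 2 by positivity)
  obtain ⟨δ', hδ', hUb⟩ := Metric.isOpen_iff.1 hU 0 h0U
  set L := fderiv ℝ φ 0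
  set B := fderiv ℝ (fderiv ℝ φ) 0
  have hlim : Tendsto (fun k : ℕ => R / √(k : ℝ)) atTop (nhds 0) :=
    (Real.tendsto_sqrt_atTop.comp tendsto_natCast_atTop_atTop).const_div_atTop R
  filter_upwards [hlim.eventually_lt_const hδ, hlim.eventually_lt_const hδ', eventually_gt_atTop 0]
    with k hkδ hkδ' hk0 f hf hint
  have hk : (0 : ℝ) < k := by exact_mod_cast hk0
  set r := R / √(k : ℝ) with hr
  set F : (Fin n → ℂ) → ℂ := fun z => f z * Complex.exp (-(k / 2 : ℂ) * (bmLin L z + bmQuad B z)) with hF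
  have hbU : Metric.ball (0 : Fin n → ℂ) r ⊆ U := (Metric.ball_subset_ball hkδ'.le).trans hUb
  have hmean := bm_mean (r := r) F
    (by
      refine (hf.continuousOn.mono hbU).mul (Continuous.continuousOn ?_)
      unfold bmLin bmQuad
      fun_prop)
    (by
      intro z hz
      simp only [hF, bmLin_smul, bmQuad_smul]
      refine DifferentiableOn.mul ?_ (Differentiable.differentiableOn (by fun_prop))
      refine hf.comp (Differentiable.differentiableOn (by fun_prop)) ?_
      intro t ht
      apply hbU
      simp only [mem_closedBall_iff_norm, sub_zero, mem_ball_iff_norm] at ht hz ⊢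
      rw [norm_smul]
      nlinarith [norm_nonneg z, norm_nonneg t])
    (fun z => k * bmLevi B z) ((bmLevi_cont B).const_mul _ |> fun h => by simpa using h)
    (by intro t z ht; simp [bmLevi_smul, ht])
  have hF0 : F 0 = f 0 := by simp [hF, bmLin, bmQuad]
  rw [bm_scale hk (bmLevi B) (fun t z => by
    have := bmLevi_smul B (t : ℂ) z
    rw [Complex.norm_real, Real.norm_eq_abs, sq_abs] at this
    rw [← this]; congr 1), hF0] at hmean
  have hpt : ∀ z ∈ Metric.ball (0 : Fin n → ℂ) r,
      ‖F z‖ ^ 2 * Real.exp (-(k * bmLevi B z)) ≤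
        Real.exp (ε + k * φ 0) * (‖f z‖ ^ 2 * Real.exp (-(k : ℝ) * φ z)) := by
    intro z hz
    have hzn : ‖z‖ < r := by simpa using hz
    have h1 := (abs_le.1 (hT z (Metric.ball_subset_ball hkδ.le hz))).2
    have h2 := bm_re L B z
    have h3 : ‖F z‖ ^ 2 = ‖f z‖ ^ 2 * Real.exp (-(k * (bmLin L z + bmQuad B z).re)) := by
      simp only [hF, norm_mul, mul_pow, Complex.norm_exp]
      rw [← Real.exp_nat_mul]
      congr 2
      have : (-(k / 2 : ℂ) * (bmLin L z + bmQuad B z)).re = -((k:ℝ)/2) * (bmLin L z + bmQuad B z).re := by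
        rw [show (-(k / 2 : ℂ)) = ((-((k:ℝ)/2) : ℝ) : ℂ) by push_cast; ring, Complex.re_ofReal_mul]
      rw [this]; push_cast; ring
    have h4 : k * (ε / R ^ 2 * ‖z‖ ^ 2) ≤ ε := by
      have h5 : ‖z‖ ^ 2 ≤ r ^ 2 := by gcongr
      have h6 : r ^ 2 = R ^ 2 / k := by rw [hr, div_pow, Real.sq_sqrt hk.le]
      rw [h6] at h5
      calc k * (ε / R ^ 2 * ‖z‖ ^ 2) ≤ k * (ε / R ^ 2 * (R ^ 2 / k)) := by gcongr
        _ = ε := by field_simp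
    rw [h3, mul_assoc, ← Real.exp_add, mul_left_comm, ← Real.exp_add]
    refine mul_le_mul_of_nonneg_left (Real.exp_le_exp.2 ?_) (by positivity)
    have h7 : k * (φ z - φ 0 - ((bmLin L z + bmQuad B z).re + bmLevi B z)) ≤ ε := by
      refine le_trans (mul_le_mul_of_nonneg_left ?_ hk.le) h4
      linarith
    linarith
  have hup : ∫⁻ z in Metric.ball (0 : Fin n → ℂ) r, ENNReal.ofReal (‖F z‖ ^ 2 * Real.exp (-(k * bmLevi B z)))
      ≤ ENNReal.ofReal (Real.exp (ε + k * φ 0)) := by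
    calc _ ≤ ∫⁻ z in Metric.ball (0 : Fin n → ℂ) r, ENNReal.ofReal (Real.exp (ε + k * φ 0)) *
            ENNReal.ofReal (‖f z‖ ^ 2 * Real.exp (-(k : ℝ) * φ z)) := by
          apply setLIntegral_mono' Metric.isOpen_ball.measurableSet
          intro z hz
          rw [← ENNReal.ofReal_mul (Real.exp_pos _).le]
          exact ENNReal.ofReal_le_ofReal (hpt z hz)
      _ = ENNReal.ofReal (Real.exp (ε + k * φ 0)) * ∫⁻ z in Metric.ball (0 : Fin n → ℂ) r,
            ENNReal.ofReal (‖f z‖ ^ 2 * Real.exp (-(k : ℝ) * φ z)) := by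
          rw [lintegral_const_mul' _ _ ENNReal.ofReal_ne_top]
      _ ≤ ENNReal.ofReal (Real.exp (ε + k * φ 0)) * 1 := by
          gcongr
          exact (lintegral_mono_set hbU).trans hint
      _ = _ := mul_one _
  have hfin := hmean.trans hup
  rw [← mul_assoc, ← ENNReal.ofReal_mul (by positivity)] at hfin
  have hfin2 := mul_le_mul_right hfin (ENNReal.ofReal (Real.exp (-(k:ℝ) * φ 0)))
  rw [← mul_assoc, ← ENNReal.ofReal_mul (by positivity), ← ENNReal.ofReal_mul (by positivity),
    ← Real.exp_add] at hfin2
  rw [show ((k : ℝ) ^ n)⁻¹ * (‖f 0‖ ^ 2 * Real.exp (-(k : ℝ) * φ 0))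
    = Real.exp (-(k : ℝ) * φ 0) * (‖f 0‖ ^ 2 * ((k : ℝ) ^ n)⁻¹) by ring]
  rwa [show -(k : ℝ) * φ 0 + (ε + k * φ 0) = ε by ring] at hfin2

theorem bm_nonneg (n : ℕ) (U : Set (Fin n → ℂ)) (φ : (Fin n → ℂ) → ℝ) (k : ℕ) :
    0 ≤ ((k : ℝ) ^ n)⁻¹ * bergmanFnAtZero n U φ k := by
  refine mul_nonneg (by positivity) (Real.sSup_nonneg ?_)
  rintro r ⟨f, -, -, rfl⟩
  positivity

theorem bm_eventually {n : ℕ} {U : Set (Fin n → ℂ)} (hU : IsOpen U) (h0U : (0 : Fin n → ℂ) ∈ U)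
    {φ : (Fin n → ℂ) → ℝ} (hφ : ContDiffAt ℝ 2 φ 0) {a : ℝ} (ha : 0 < a)
    (hJ : ENNReal.ofReal a⁻¹ < ∫⁻ z : Fin n → ℂ,
      ENNReal.ofReal (Real.exp (-(star z ⬝ᵥ (complexHessian n φ 0).mulVec z).re))) :
    ∀ᶠ k : ℕ in atTop, ((k : ℝ) ^ n)⁻¹ * bergmanFnAtZero n U φ k ≤ a := by
  simp only [bm_form] at hJ
  have hun : (⋃ m : ℕ, Metric.ball (0 : Fin n → ℂ) ((m : ℝ) + 1)) = Set.univ := by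
    rw [Set.eq_univ_iff_forall]
    intro z
    obtain ⟨m, hm⟩ := exists_nat_gt ‖z‖
    refine Set.mem_iUnion.2 ⟨m, ?_⟩
    simp only [mem_ball_zero_iff]
    linarith
  rw [← setLIntegral_univ, ← hun, setLIntegral_iUnion_of_directed _ (by
    apply Monotone.directed_le
    intro m m' hmm
    apply Metric.ball_subset_ball
    have : (m : ℝ) ≤ m' := by exact_mod_cast hmm
    linarith), lt_iSup_iff] at hJ
  obtain ⟨m, hm⟩ := hJ
  obtain ⟨c, hc0, hc1, hc2⟩ := ENNReal.lt_iff_exists_real_btwn.1 hm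
  have hac : a⁻¹ < c := (ENNReal.ofReal_lt_ofReal_iff_of_nonneg (by positivity)).1 hc1
  have hca : 1 < c * a := by
    rwa [inv_lt_iff_one_lt_mul₀ ha] at hac
  have hcpos : 0 < c := lt_trans (by positivity) hac
  have hεpos : 0 < Real.log (c * a) := Real.log_pos hca
  filter_upwards [bm_core hU h0U hφ (R := (m : ℝ) + 1) (by positivity) hεpos, eventually_gt_atTop 0]
    with k hk hk0
  have hkn : (0 : ℝ) < (k : ℝ) ^ n := by positivity
  rw [inv_mul_le_iff₀ hkn]
  refine Real.sSup_le ?_ (by positivity)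
  rintro x ⟨f, hf, hint, rfl⟩
  rw [← inv_mul_le_iff₀ hkn]
  have h1 := hk f hf hint
  rw [Real.exp_log (by positivity)] at h1
  have h2 := (mul_le_mul_right hc2.le _).trans h1
  rw [← ENNReal.ofReal_mul (by positivity), ENNReal.ofReal_le_ofReal_iff (by positivity),
    mul_comm c a] at h2
  exact le_of_mul_le_mul_right h2 hcpos

/-- **Pointwise local holomorphic Morse inequality for the Bergman function.** Let `U` be an
open neighbourhood of `0` in `ℂ^n` and `φ : U → ℝ` a `C²` function with complex Hessian `H`
at `0`. Then `limsup_k k^{-n} B_k(0) ≤ π^{-n} det H` if `H` is positive definite, and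
`k^{-n} B_k(0) → 0` if `H` is not positive definite. -/
theorem bergman_function_local_morse_inequality
    (n : ℕ) (U : Set (Fin n → ℂ)) (hU : IsOpen U) (h0U : (0 : Fin n → ℂ) ∈ U)
    (φ : (Fin n → ℂ) → ℝ) (hφ : ContDiffOn ℝ 2 φ U) :
    (((complexHessian n φ 0).PosDef →
      limsup (fun k : ℕ => ((k : ℝ) ^ n)⁻¹ * bergmanFnAtZero n U φ k) atTop
        ≤ (Real.pi ^ n)⁻¹ * ((complexHessian n φ 0).det).re)) ∧
    (¬ (complexHessian n φ 0).PosDef →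
      Tendsto (fun k : ℕ => ((k : ℝ) ^ n)⁻¹ * bergmanFnAtZero n U φ k) atTop (nhds 0)) := by
  have hφ0 : ContDiffAt ℝ 2 φ 0 := hφ.contDiffAt (hU.mem_nhds h0U)
  have hherm := bm_herm hφ0
  refine ⟨fun hpos => ?_, fun hnot => ?_⟩
  · have hdet : 0 < (complexHessian n φ 0).det.re := by
      have := hpos.det_pos
      rw [Complex.lt_def] at this
      exact this.1
    refine le_of_forall_gt_imp_ge_of_dense fun a ha => ?_
    have hpos' : 0 < (Real.pi ^ n)⁻¹ * (complexHessian n φ 0).det.re := by positivity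
    have ha0 : 0 < a := hpos'.trans ha
    refine limsup_le_of_le ?_ (bm_eventually hU h0U hφ0 ha0 ?_)
    · exact isCoboundedUnder_le_of_le atTop (x := 0) fun k => bm_nonneg n U φ k
    · rw [bm_gauss_posDef hpos]
      refine (ENNReal.ofReal_lt_ofReal_iff (by positivity)).2 ?_
      calc a⁻¹ < ((Real.pi ^ n)⁻¹ * (complexHessian n φ 0).det.re)⁻¹ := inv_strictAnti₀ hpos' ha
        _ = _ := by rw [mul_inv, inv_inv, div_eq_mul_inv]
  · rw [tendsto_order]
    refine ⟨fun b hb => Eventually.of_forall fun k => hb.trans_le (bm_nonneg n U φ k), fun b hb => ?_⟩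
    have h := bm_eventually hU h0U hφ0 (half_pos hb) (by
      rw [bm_gauss_not_posDef hherm hnot]; exact ENNReal.ofReal_lt_top)
    filter_upwards [h] with k hk
    linarith
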